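/- Let r > 0 and let f : {x ∈ ℝ³ : |x| ≥ r} → ℝ be subharmonic for |x| > r (that is, Δf ≥ 0 in the sense of distributions on {|x| > r}), continuous on {|x| ≥ r}, and vanishing at infinity. Then sup_{|x| ≥ r} |x| f(x) = sup_{|x| = r} |x| f(x). -/

import Mathlib

open MeasureTheory Real Filter
open scoped ENNReal NNReal

noncomputable section

/-- Three-dimensional Euclidean space. -/
abbrev E3 : Type := EuclideanSpace ℝ (Fin 3)

/-- The Laplacian on `ℝ³` as a sum of second partial derivatives. -/
def lap (f : E3 → ℝ) (x : E3) : ℝ :=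
  ∑ i : Fin 3,
    fderiv ℝ (fun y => fderiv ℝ f y (EuclideanSpace.single i 1)) x (EuclideanSpace.single i 1)

open scoped Topology Convolution

/-- The second derivative of a function is nonpositive at a local maximum. -/
theorem IsLocalMax.second_deriv_nonpos {h h' : ℝ → ℝ} {a t₀ : ℝ} (hmax : IsLocalMax h t₀)
    (hd : ∀ᶠ t in 𝓝 t₀, HasDerivAt h (h' t) t) (hd' : HasDerivAt h' a t₀) : a ≤ 0 := by
  by_contra! ha
  have hderiv : deriv h =ᶠ[𝓝 t₀] h' := hd.mono fun t ht => ht.deriv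
  have h2 : deriv (deriv h) t₀ = a := hderiv.deriv_eq.trans hd'.deriv
  have hmin : IsLocalMin h t₀ :=
    isLocalMin_of_deriv_deriv_pos (h2 ▸ ha) hmax.deriv_eq_zero hd.self_of_nhds.continuousAt
  have hconst : h =ᶠ[𝓝 t₀] fun _ => h t₀ := by
    filter_upwards [hmax, hmin] with t h1 h2 using le_antisymm h1 h2
  have hzero : deriv (deriv h) t₀ = 0 := by
    rw [hconst.deriv.deriv_eq]
    simp
  linarith

section LineDerivatives

variable {V : Type*} [NormedAddCommGroup V] [InnerProductSpace ℝ V]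

theorem norm_add_smul_sq {e : V} (he : ‖e‖ = 1) (x : V) (t : ℝ) :
    ‖x + t • e‖ ^ 2 = ‖x‖ ^ 2 + 2 * t * inner ℝ x e + t ^ 2 := by
  rw [norm_add_sq_real, inner_smul_right, norm_smul, he, Real.norm_eq_abs, mul_one, sq_abs]
  ring

theorem hasDerivAt_norm_add_smul_sq {e : V} (he : ‖e‖ = 1) (x : V) (t : ℝ) :
    HasDerivAt (fun t : ℝ => ‖x + t • e‖ ^ 2) (2 * (inner ℝ x e + t)) t := by
  simp_rw [norm_add_smul_sq he x]
  have h := ((((hasDerivAt_id' t).const_mul 2).mul_const (inner ℝ x e)).const_add (‖x‖ ^ 2)).fun_add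
    ((hasDerivAt_id' t).fun_pow 2)
  exact h.congr_deriv (by push_cast; ring)

theorem hasDerivAt_norm_add_smul {e : V} (he : ‖e‖ = 1) (x : V) {t : ℝ} (hx : x + t • e ≠ 0) :
    HasDerivAt (fun t : ℝ => ‖x + t • e‖) ((inner ℝ x e + t) / ‖x + t • e‖) t := by
  have h := (hasDerivAt_norm_add_smul_sq he x t).sqrt (by positivity)
  simp only [Real.sqrt_sq (norm_nonneg _)] at h
  exact h.congr_deriv (mul_div_mul_left _ _ two_ne_zero)

theorem hasDerivAt_inv_norm_add_smul {e : V} (he : ‖e‖ = 1) (x : V) {t : ℝ}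
    (hx : x + t • e ≠ 0) :
    HasDerivAt (fun t : ℝ => ‖x + t • e‖⁻¹) (-(inner ℝ x e + t) / ‖x + t • e‖ ^ 3) t := by
  have hn : ‖x + t • e‖ ≠ 0 := norm_ne_zero_iff.2 hx
  exact ((hasDerivAt_norm_add_smul he x hx).fun_inv hn).congr_deriv (by field_simp)

theorem hasDerivAt_deriv_inv_norm_add_smul {e : V} (he : ‖e‖ = 1) {x : V} (hx : x ≠ 0) :
    HasDerivAt (fun t : ℝ => -(inner ℝ x e + t) / ‖x + t • e‖ ^ 3)
      (3 * inner ℝ x e ^ 2 / ‖x‖ ^ 5 - 1 / ‖x‖ ^ 3) 0 := by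
  have hn : ‖x‖ ≠ 0 := norm_ne_zero_iff.2 hx
  have h := (((hasDerivAt_id' (0 : ℝ)).const_add (inner ℝ x e)).fun_neg).fun_div
    ((hasDerivAt_norm_add_smul he x (t := 0) (by simpa using hx)).fun_pow 3) (by simpa using hx)
  refine h.congr_deriv ?_
  simp only [zero_smul, add_zero]
  field_simp
  ring

end LineDerivatives

theorem hasDerivAt_convolution_line {F ρ : E3 → ℝ} (hF : Continuous F) (hρ : ContDiff ℝ 1 ρ)
    (hc : HasCompactSupport ρ) (x e : E3) (t : ℝ) :
    HasDerivAt (fun t : ℝ => (F ⋆[ContinuousLinearMap.mul ℝ ℝ] ρ) (x + t • e))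
      ((F ⋆[ContinuousLinearMap.mul ℝ ℝ] fun y => fderiv ℝ ρ y e) (x + t • e)) t := by
  have h := hc.hasFDerivAt_convolution_right (ContinuousLinearMap.mul ℝ ℝ)
    (hF.locallyIntegrable (μ := volume)) hρ (x + t • e)
  have hl : HasDerivAt (fun t : ℝ => x + t • e) e t := by
    simpa using ((hasDerivAt_id t).smul_const e).const_add x
  have := h.comp_hasDerivAt t hl
  rwa [convolution_precompR_apply _ hF.locallyIntegrable (hc.fderiv ℝ)
    (hρ.continuous_fderiv one_ne_zero)] at this

theorem contDiff_fderiv_apply_const {ρ : E3 → ℝ} (hρ : ContDiff ℝ (⊤ : ℕ∞) ρ) (e : E3) :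
    ContDiff ℝ (⊤ : ℕ∞) (fun y => fderiv ℝ ρ y e) :=
  (hρ.fderiv_right (m := (⊤ : ℕ∞)) (by simp)).clm_apply contDiff_const

theorem fderiv_comp_const_sub_apply {ρ : E3 → ℝ} (x t e : E3) :
    fderiv ℝ (fun y => ρ (x - y)) t e = -fderiv ℝ ρ (x - t) e := by
  have h := (ContinuousLinearEquiv.neg ℝ (M := E3)).comp_right_fderiv (f := fun z => ρ (x + z))
    (x := t)
  simp only [Function.comp_def, ContinuousLinearEquiv.neg_apply, ← sub_eq_add_neg,
    fderiv_comp_add_left] at h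
  simp [h]

theorem lap_comp_const_sub (ρ : E3 → ℝ) (x t : E3) :
    lap (fun y => ρ (x - y)) t = lap ρ (x - t) := by
  unfold lap
  refine Finset.sum_congr rfl fun i _ => ?_
  simp_rw [fderiv_comp_const_sub_apply]
  rw [fderiv_fun_neg, neg_apply,
    fderiv_comp_const_sub_apply (ρ := fun z => fderiv ℝ ρ z (EuclideanSpace.single i 1)), neg_neg]

theorem lap_eq_zero_of_notMem_tsupport {g : E3 → ℝ} {x : E3} (hx : x ∉ tsupport g) :
    lap g x = 0 := by
  unfold lap
  refine Finset.sum_eq_zero fun i _ => ?_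
  have h0 : g =ᶠ[𝓝 x] fun _ => (0 : ℝ) := notMem_tsupport_iff_eventuallyEq.1 hx
  have h1 : (fun y => fderiv ℝ g y (EuclideanSpace.single i 1)) =ᶠ[𝓝 x]
      fun _ => (0 : ℝ) := by
    filter_upwards [h0.fderiv (𝕜 := ℝ)] with y hy
    simp [hy]
  rw [h1.fderiv_eq]
  simp

theorem sum_convolution_second_deriv {F ρ : E3 → ℝ} (hF : Continuous F)
    (hρ : ContDiff ℝ (⊤ : ℕ∞) ρ) (hc : HasCompactSupport ρ) (x : E3) :
    ∑ i : Fin 3, (F ⋆[ContinuousLinearMap.mul ℝ ℝ] fun z =>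
      fderiv ℝ (fun y => fderiv ℝ ρ y (EuclideanSpace.single i 1)) z (EuclideanSpace.single i 1)) x
      = ∫ t, F t * lap (fun y => ρ (x - y)) t := by
  simp_rw [lap_comp_const_sub]
  unfold lap
  simp_rw [Finset.mul_sum]
  rw [integral_finsetSum]
  · rfl
  · intro i _
    have hs := contDiff_fderiv_apply_const
      (contDiff_fderiv_apply_const hρ (EuclideanSpace.single i 1)) (EuclideanSpace.single i 1)
    have hcs := (hc.fderiv_apply ℝ (EuclideanSpace.single i 1)).fderiv_apply ℝ
      (EuclideanSpace.single i 1)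
    exact hcs.convolutionExists_right (ContinuousLinearMap.mul ℝ ℝ)
      (hF.locallyIntegrable (μ := volume)) hs.continuous x

/-- `F` is subharmonic on `{|x| > r}` in the sense of distributions. -/
def SubharmonicOutside (r : ℝ) (F : E3 → ℝ) : Prop :=
  ∀ g : E3 → ℝ, ContDiff ℝ (⊤ : ℕ∞) g → HasCompactSupport g → (∀ x, 0 ≤ g x) →
    tsupport g ⊆ {x : E3 | r < ‖x‖} → 0 ≤ ∫ x : E3, F x * lap g x

/-- Distributional subharmonicity gives pointwise subharmonicity of mollifications. -/
theorem SubharmonicOutside.sum_second_deriv_mollification_nonneg {r : ℝ} {F : E3 → ℝ}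
    (hsub : SubharmonicOutside r F) (hF : Continuous F) (φ : ContDiffBump (0 : E3)) {x : E3}
    (hx : r + φ.rOut < ‖x‖) :
    0 ≤ ∑ i : Fin 3, (F ⋆[ContinuousLinearMap.mul ℝ ℝ] fun z =>
      fderiv ℝ (fun y => fderiv ℝ (φ.normed volume) y (EuclideanSpace.single i 1)) z
        (EuclideanSpace.single i 1)) x := by
  rw [sum_convolution_second_deriv hF φ.contDiff_normed φ.hasCompactSupport_normed]
  have hts : tsupport (fun y => φ.normed volume (x - y)) ⊆ Metric.closedBall x φ.rOut := by
    refine closure_minimal (fun y hy => ?_) Metric.isClosed_closedBall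
    have : x - y ∈ Function.support (φ.normed volume) := hy
    rw [φ.support_normed_eq, mem_ball_zero_iff] at this
    rw [Metric.mem_closedBall, dist_comm, dist_eq_norm]
    exact this.le
  refine hsub _ (φ.contDiff_normed.comp (contDiff_const.sub contDiff_id))
    ((isCompact_closedBall x φ.rOut).of_isClosed_subset (isClosed_tsupport _) hts)
    (fun y => φ.nonneg_normed _) fun y hy => ?_
  have h1 := hts hy
  rw [Metric.mem_closedBall, dist_comm, dist_eq_norm] at h1
  have h2 := norm_sub_norm_le x y
  simp only [Set.mem_ofPred_eq]
  linarith

/-- A mollification of a distributionally subharmonic function, perturbed by `-c / |x| + ε |x|²`,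
has no local maximum. -/
theorem SubharmonicOutside.not_isLocalMax {r : ℝ} (hr : 0 < r) {F : E3 → ℝ}
    (hsub : SubharmonicOutside r F) (hF : Continuous F) (φ : ContDiffBump (0 : E3)) {x : E3}
    (hx : r + φ.rOut < ‖x‖) (c : ℝ) {ε : ℝ} (hε : 0 < ε) :
    ¬ IsLocalMax (fun y => (F ⋆[ContinuousLinearMap.mul ℝ ℝ] φ.normed volume) y
      - c * ‖y‖⁻¹ + ε * ‖y‖ ^ 2) x := by
  intro hmax
  have hx0 : x ≠ 0 := by
    have := φ.rOut_pos
    exact norm_pos_iff.1 (by linarith)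
  have hsum := hsub.sum_second_deriv_mollification_nonneg hF φ hx
  have key : ∀ i : Fin 3, (F ⋆[ContinuousLinearMap.mul ℝ ℝ] fun z =>
      fderiv ℝ (fun y => fderiv ℝ (φ.normed volume) y (EuclideanSpace.single i 1)) z
        (EuclideanSpace.single i 1)) x
      - c * (3 * x i ^ 2 / ‖x‖ ^ 5 - 1 / ‖x‖ ^ 3) + ε * 2 ≤ 0 := by
    intro i
    have he : ‖(EuclideanSpace.single i 1 : E3)‖ = 1 := by simp
    have hin : inner ℝ x (EuclideanSpace.single i 1 : E3) = x i := by
      simp [EuclideanSpace.inner_single_right]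
    rw [← hin]
    set e : E3 := EuclideanSpace.single i 1
    have hline : Continuous fun t : ℝ => x + t • e := by fun_prop
    have hmax' : IsLocalMax (fun t : ℝ =>
        (F ⋆[ContinuousLinearMap.mul ℝ ℝ] φ.normed volume) (x + t • e)
          - c * ‖x + t • e‖⁻¹ + ε * ‖x + t • e‖ ^ 2) 0 := by
      have hlim : Tendsto (fun t : ℝ => x + t • e) (𝓝 0) (𝓝 x) := by
        simpa using hline.tendsto 0
      filter_upwards [hlim.eventually hmax] with t ht
      simpa using ht
    have hne : ∀ᶠ t : ℝ in 𝓝 0, x + t • e ≠ 0 :=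
      hline.continuousAt.eventually_ne (by simpa using hx0)
    refine hmax'.second_deriv_nonpos (hne.mono fun t ht =>
      ((hasDerivAt_convolution_line hF φ.contDiff_normed φ.hasCompactSupport_normed x e t).fun_sub
        ((hasDerivAt_inv_norm_add_smul he x ht).const_mul c)).fun_add
        ((hasDerivAt_norm_add_smul_sq he x t).const_mul ε)) ?_
    have h1 := hasDerivAt_convolution_line hF
      ((contDiff_fderiv_apply_const (φ.contDiff_normed (μ := volume)) e).of_le (by simp))
      (φ.hasCompactSupport_normed.fderiv_apply ℝ e) x e 0
    have h2 := (hasDerivAt_deriv_inv_norm_add_smul he hx0).const_mul c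
    have h3 := (((hasDerivAt_id' (0 : ℝ)).const_add (inner ℝ x e)).const_mul 2).const_mul ε
    simp only [zero_smul, add_zero, mul_one] at h1 h3
    exact (h1.fun_sub h2).fun_add h3
  have hn : ‖x‖ ^ 2 = x 0 ^ 2 + x 1 ^ 2 + x 2 ^ 2 := by
    simp [EuclideanSpace.norm_sq_eq, Fin.sum_univ_three]
  have hharm : (3 * x 0 ^ 2 / ‖x‖ ^ 5 - 1 / ‖x‖ ^ 3) + (3 * x 1 ^ 2 / ‖x‖ ^ 5 - 1 / ‖x‖ ^ 3)
      + (3 * x 2 ^ 2 / ‖x‖ ^ 5 - 1 / ‖x‖ ^ 3) = 0 := by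
    have hpos : ‖x‖ ≠ 0 := norm_ne_zero_iff.2 hx0
    field_simp
    linear_combination (-3) * hn
  rw [Fin.sum_univ_three] at hsum
  have hc := congrArg (c * ·) hharm
  simp only [mul_add, mul_zero] at hc
  linarith [key 0, key 1, key 2]

/-- Mollifications of a continuous function converge uniformly on bounded sets. -/
theorem exists_mollification_close {F : E3 → ℝ} (hF : Continuous F) (R : ℝ) {η δ : ℝ}
    (hη : 0 < η) (hδ : 0 < δ) :
    ∃ φ : ContDiffBump (0 : E3), φ.rOut < δ ∧ ∀ x : E3, ‖x‖ ≤ R →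
      |(F ⋆[ContinuousLinearMap.mul ℝ ℝ] φ.normed volume) x - F x| ≤ η := by
  have huc := (isCompact_closedBall (0 : E3) (R + 1)).uniformContinuousOn_of_continuous
    hF.continuousOn
  obtain ⟨d, hd, hdF⟩ := Metric.uniformContinuousOn_iff.1 huc η hη
  have hm : 0 < min (min d 1) δ := by positivity
  refine ⟨⟨min (min d 1) δ / 4, min (min d 1) δ / 2, by positivity, by linarith⟩, ?_, ?_⟩
  · have := min_le_right (min d 1) δ
    simp only
    linarith
  · intro x hx
    set φ : ContDiffBump (0 : E3) :=
      ⟨min (min d 1) δ / 4, min (min d 1) δ / 2, by positivity, by linarith⟩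
    have hconv : F ⋆[ContinuousLinearMap.mul ℝ ℝ] φ.normed volume =
        φ.normed volume ⋆[ContinuousLinearMap.lsmul ℝ ℝ] F := by
      rw [← convolution_flip]
      congr 1
      ext
      simp
    rw [hconv, ← Real.dist_eq]
    refine φ.dist_normed_convolution_le hF.aestronglyMeasurable fun y hy => ?_
    have h1 : dist y x < min (min d 1) δ / 2 := hy
    have h2 := min_le_left (min d 1) δ
    have h3 := min_le_left d 1
    have h4 := min_le_right d 1
    have h5 : ‖y‖ ≤ ‖x‖ + dist y x := by
      rw [dist_eq_norm]
      linarith [norm_sub_norm_le y x]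
    exact (hdF y (by rw [mem_closedBall_zero_iff]; linarith) x
      (by rw [mem_closedBall_zero_iff]; linarith) (by linarith)).le

/-- A continuous function vanishing at infinity and distributionally subharmonic on `{|x| > r}` is
dominated on `{|x| ≥ r}` by `c / |x|` as soon as it is on the sphere `{|x| = r}`. -/
theorem SubharmonicOutside.norm_mul_le {r : ℝ} (hr : 0 < r) {F : E3 → ℝ}
    (hsub : SubharmonicOutside r F) (hF : Continuous F) (hvanish : Tendsto F (cocompact E3) (𝓝 0))
    {c : ℝ} (hc : ∀ x : E3, ‖x‖ = r → ‖x‖ * F x ≤ c) {x₀ : E3} (hx₀ : r ≤ ‖x₀‖) :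
    ‖x₀‖ * F x₀ ≤ c := by
  by_contra! hlt
  have hx₀pos : 0 < ‖x₀‖ := hr.trans_le hx₀
  set u : E3 → ℝ := fun x => F x - c * ‖x‖⁻¹ with hu
  have hη : 0 < u x₀ := by
    have : c * ‖x₀‖⁻¹ < F x₀ := by
      rw [← div_eq_mul_inv, div_lt_iff₀ hx₀pos]
      linarith
    simp only [hu]
    linarith
  set η := u x₀ with hηdef
  have hu_sphere : ∀ x : E3, ‖x‖ = r → u x ≤ 0 := by
    intro x hx
    have h := hc x hx
    rw [hx] at h
    have : F x ≤ c * r⁻¹ := by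
      rw [← div_eq_mul_inv, le_div_iff₀ hr]
      linarith
    simp only [hu, hx]
    linarith
  have hu_lim : Tendsto u (cocompact E3) (𝓝 0) := by
    simpa using hvanish.sub
      ((tendsto_inv_atTop_zero.comp (tendsto_norm_cocompact_atTop (E := E3))).const_mul c)
  obtain ⟨R, hR⟩ : ∃ R : ℝ, ∀ x : E3, R ≤ ‖x‖ → u x < η / 2 := by
    have hev := hu_lim.eventually_lt_const (half_pos hη)
    rw [← Metric.cobounded_eq_cocompact, ← comap_norm_atTop, eventually_comap] at hev
    obtain ⟨R, hR⟩ := eventually_atTop.1 hev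
    exact ⟨R, fun x hx => hR _ hx x rfl⟩
  have hx₀R : ‖x₀‖ < R := by
    by_contra! h
    linarith [hR x₀ h]
  set K : Set E3 := {x | r ≤ ‖x‖ ∧ ‖x‖ ≤ R} with hK
  have hKcomp : IsCompact K := by
    refine (isCompact_closedBall (0 : E3) R).of_isClosed_subset ?_ fun x hx => by simpa using hx.2
    exact (isClosed_le continuous_const continuous_norm).inter
      (isClosed_le continuous_norm continuous_const)
  have hinv : ContinuousOn (fun x : E3 => c * ‖x‖⁻¹) K :=
    continuousOn_const.mul (continuous_norm.continuousOn.inv₀ fun x hx => (hr.trans_le hx.1).ne')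
  have hucont : ContinuousOn u K := hF.continuousOn.sub hinv
  have hx₀K : x₀ ∈ K := ⟨hx₀, hx₀R.le⟩
  obtain ⟨r₁, hr₁, hsmall⟩ : ∃ r₁ > r, ∀ x ∈ K, ‖x‖ ≤ r₁ → u x < η / 2 := by
    have hLcomp : IsCompact (K ∩ u ⁻¹' Set.Ici (η / 2)) :=
      hKcomp.of_isClosed_subset (hucont.preimage_isClosed_of_isClosed hKcomp.isClosed isClosed_Ici)
        Set.inter_subset_left
    obtain ⟨z, ⟨hzK, hzu⟩, hzmin⟩ := hLcomp.exists_isMinOn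
      ⟨x₀, hx₀K, show η / 2 ≤ u x₀ by linarith⟩ continuous_norm.continuousOn
    have hzr : r < ‖z‖ := by
      refine lt_of_le_of_ne hzK.1 fun h => ?_
      have h1 := hu_sphere z h.symm
      have h2 : η / 2 ≤ u z := hzu
      linarith
    refine ⟨(r + ‖z‖) / 2, by linarith, fun x hx hxr => ?_⟩
    by_contra! h
    have : ‖z‖ ≤ ‖x‖ := hzmin ⟨hx, h⟩
    linarith
  obtain ⟨φ, hφ, hclose⟩ := exists_mollification_close hF R (show 0 < η / 8 by linarith)
    (sub_pos.2 hr₁)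
  have hRpos : 0 < R := hx₀pos.trans hx₀R
  set ε := η / (8 * R ^ 2) with hεdef
  have hε : 0 < ε := by positivity
  have hεR : ε * R ^ 2 = η / 8 := by
    rw [hεdef]
    field_simp
  set w : E3 → ℝ := fun y => (F ⋆[ContinuousLinearMap.mul ℝ ℝ] φ.normed volume) y
      - c * ‖y‖⁻¹ + ε * ‖y‖ ^ 2 with hw
  have hmoll : Continuous (F ⋆[ContinuousLinearMap.mul ℝ ℝ] φ.normed volume) :=
    φ.hasCompactSupport_normed.continuous_convolution_right _ hF.locallyIntegrable
      φ.continuous_normed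
  obtain ⟨x, hxK, hxmax⟩ := hKcomp.exists_isMaxOn ⟨x₀, hx₀K⟩
    (show ContinuousOn w K from (hmoll.continuousOn.sub hinv).add (by fun_prop))
  have hux : η / 2 < u x := by
    have h1 : w x₀ ≤ w x := hxmax hx₀K
    have h2 := abs_le.1 (hclose x hxK.2)
    have h3 := abs_le.1 (hclose x₀ hx₀K.2)
    have h4 : ε * ‖x‖ ^ 2 ≤ ε * R ^ 2 := by
      have := hxK.2
      gcongr
    have h5 : 0 ≤ ε * ‖x₀‖ ^ 2 := by positivity
    have h6 : η = F x₀ - c * ‖x₀‖⁻¹ := rfl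
    simp only [hw] at h1
    simp only [hu]
    linarith [h2.2, h3.1]
  have hxr₁ : r₁ < ‖x‖ := by
    by_contra! h
    linarith [hsmall x hxK h]
  have hxR : ‖x‖ < R := by
    by_contra! h
    linarith [hR x h]
  have hKnhds : K ∈ 𝓝 x := by
    filter_upwards [(continuous_norm.tendsto x).eventually_const_lt (hr₁.trans hxr₁),
      (continuous_norm.tendsto x).eventually_lt_const hxR] with y h1 h2 using ⟨h1.le, h2.le⟩
  exact hsub.not_isLocalMax hr hF φ (by linarith) c hε (hxmax.isLocalMax hKnhds)

/-- **Maximum principle for subharmonic functions** (Lemma 6.5): if `f` is subharmonic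
(in the distributional sense) on `{|x| > r}`, continuous on `{|x| ≥ r}` and vanishes at
infinity, then `sup_{|x| ≥ r} |x| f(x) = sup_{|x| = r} |x| f(x)`. -/
theorem subharmonic_max_principle (r : ℝ) (hr : 0 < r) (f : E3 → ℝ)
    (hcont : ContinuousOn f {x : E3 | r ≤ ‖x‖})
    (hsub : ∀ g : E3 → ℝ, ContDiff ℝ (⊤ : ℕ∞) g → HasCompactSupport g →
      (∀ x, 0 ≤ g x) → tsupport g ⊆ {x : E3 | r < ‖x‖} →
      0 ≤ ∫ x : E3, f x * lap g x)
    (hvanish : Tendsto f (cocompact E3) (nhds 0)) :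
    sSup ((fun x : E3 => ‖x‖ * f x) '' {x : E3 | r ≤ ‖x‖}) =
      sSup ((fun x : E3 => ‖x‖ * f x) '' {x : E3 | ‖x‖ = r}) := by
  obtain ⟨p, hp⟩ := (NormedSpace.sphere_nonempty (x := (0 : E3))).2 hr.le
  have hclosed : IsClosed {x : E3 | r ≤ ‖x‖} := isClosed_le continuous_const continuous_norm
  obtain ⟨G, hG⟩ := ContinuousMap.exists_restrict_eq hclosed ⟨_, hcont.domRestrict⟩
  have hGf : ∀ x : E3, r ≤ ‖x‖ → G x = f x := fun x hx => congrArg (fun k => k ⟨x, hx⟩) hG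
  have hGsub : SubharmonicOutside r G := by
    intro g hg hgc hg0 hgs
    convert hsub g hg hgc hg0 hgs using 3 with x
    by_cases hx : x ∈ tsupport g
    · rw [hGf x (le_of_lt (hgs hx))]
    · simp [lap_eq_zero_of_notMem_tsupport hx]
  have hGvanish : Tendsto G (cocompact E3) (𝓝 0) := by
    refine hvanish.congr' ?_
    filter_upwards [(tendsto_norm_cocompact_atTop (E := E3)).eventually_ge_atTop r] with x hx
    exact (hGf x hx).symm
  obtain ⟨q, hq, hqmax⟩ := (isCompact_sphere (0 : E3) r).exists_isMaxOn ⟨p, hp⟩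
    (continuous_norm.mul G.continuous).continuousOn
  have hqr : ‖q‖ = r := mem_sphere_zero_iff_norm.1 hq
  have hsphere : ∀ x : E3, ‖x‖ = r → ‖x‖ * G x ≤ ‖q‖ * G q := fun x hx =>
    hqmax (mem_sphere_zero_iff_norm.2 hx)
  have hbound : ∀ x : E3, r ≤ ‖x‖ → ‖x‖ * f x ≤ ‖q‖ * f q := by
    intro x hx
    rw [← hGf x hx, ← hGf q hqr.ge]
    exact hGsub.norm_mul_le hr G.continuous hGvanish hsphere hx
  have h1 : IsGreatest ((fun x : E3 => ‖x‖ * f x) '' {x : E3 | r ≤ ‖x‖}) (‖q‖ * f q) :=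
    ⟨⟨q, hqr.ge, rfl⟩, by rintro _ ⟨x, hx, rfl⟩; exact hbound x hx⟩
  have h2 : IsGreatest ((fun x : E3 => ‖x‖ * f x) '' {x : E3 | ‖x‖ = r}) (‖q‖ * f q) :=
    ⟨⟨q, hqr, rfl⟩, by rintro _ ⟨x, hx, rfl⟩; exact hbound x (le_of_eq (Eq.symm hx))⟩
  rw [h1.csSup_eq, h2.csSup_eq]
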